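/- arXiv:2103.11659 — 4 statements merged into one kernel-verified Lean document; each statement's English description precedes it below -/
import Mathlib

section
/- K_n x = 0 if and only if the consensus parts of all blocks agree, i.e. for all i, j ∈ {1, …, N} and all p ∈ {1, …, n}, the coordinate x_{o_i + p} equals x_{o_j + p}. -/
/-- The partial-consensus matrix `K_n`, acting on the stacked space
`ℝ^{N̄} ≅ {(i, p) : i ∈ Fin N, p ∈ Fin (nn i)} → ℝ` (coordinate `o i + p` of a stacked
vector corresponds to the pair `(i, p)`):  `(K_n)_{(i,p),(j,q)} = L i j` if `p = q < n`,
and `0` otherwise. -/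
def partialConsensusMatrix (N : ℕ) (nn : Fin N → ℕ) (n : ℕ)
    (L : Matrix (Fin N) (Fin N) ℝ) :
    Matrix ((i : Fin N) × Fin (nn i)) ((i : Fin N) × Fin (nn i)) ℝ :=
  fun a b => if (a.2 : ℕ) = (b.2 : ℕ) ∧ (a.2 : ℕ) < n then L a.1 b.1 else 0

/-- On the consensus coordinate `p` of every block, `K_n` acts as `L`. -/
theorem partialConsensusMatrix_mulVec_of_lt {N : ℕ} {nn : Fin N → ℕ} {n : ℕ}
    (L : Matrix (Fin N) (Fin N) ℝ) (hle : ∀ i, n ≤ nn i)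
    (x : ((i : Fin N) × Fin (nn i)) → ℝ) (i : Fin N) (p : ℕ) (hp : p < n) :
    (partialConsensusMatrix N nn n L).mulVec x ⟨i, ⟨p, hp.trans_le (hle i)⟩⟩ =
      L.mulVec (fun j => x ⟨j, ⟨p, hp.trans_le (hle j)⟩⟩) i := by
  simp only [Matrix.mulVec, dotProduct, partialConsensusMatrix, Fintype.sum_sigma]
  refine Finset.sum_congr rfl fun j _ => ?_
  rw [Finset.sum_eq_single (⟨p, hp.trans_le (hle j)⟩ : Fin (nn j))]
  · simp [hp]
  · intro q _ hq
    have hpq : p ≠ q := fun h => hq (Fin.ext h.symm)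
    simp [hpq]
  · simp

/-- `K_n` annihilates every coordinate outside the consensus parts. -/
theorem partialConsensusMatrix_mulVec_of_le {N : ℕ} {nn : Fin N → ℕ} {n : ℕ}
    (L : Matrix (Fin N) (Fin N) ℝ) (x : ((i : Fin N) × Fin (nn i)) → ℝ)
    (a : (i : Fin N) × Fin (nn i)) (ha : n ≤ a.2) :
    (partialConsensusMatrix N nn n L).mulVec x a = 0 := by
  simp [Matrix.mulVec, dotProduct, partialConsensusMatrix, ha.not_gt]

/-- For the partial-consensus matrix built from the Laplacian of a
connected graph, `K_n x = 0` iff all consensus parts agree: `x_{o_i+p} = x_{o_j+p}`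
for all `i, j` and all `p < n`. -/
theorem stmt1 (N : ℕ) (hN : 1 ≤ N) (nn : Fin N → ℕ) (hnn : ∀ i, 1 ≤ nn i)
    (n : ℕ) (hn : 1 ≤ n) (hle : ∀ i, n ≤ nn i)
    (G : SimpleGraph (Fin N)) [DecidableRel G.Adj] (hG : G.Connected)
    (x : ((i : Fin N) × Fin (nn i)) → ℝ) :
    (partialConsensusMatrix N nn n (G.lapMatrix ℝ)).mulVec x = 0 ↔
      ∀ (i j : Fin N) (p : ℕ) (hp : p < n),
        x ⟨i, ⟨p, lt_of_lt_of_le hp (hle i)⟩⟩ = x ⟨j, ⟨p, lt_of_lt_of_le hp (hle j)⟩⟩ := by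
  constructor
  · intro h i j p hp
    refine (G.lapMatrix_mulVec_eq_zero_iff_forall_reachable
      (x := fun j => x ⟨j, ⟨p, hp.trans_le (hle j)⟩⟩)).1 ?_ i j (hG.preconnected i j)
    ext k
    rw [← partialConsensusMatrix_mulVec_of_lt _ hle x k p hp, h]
    rfl
  · rintro h
    ext ⟨i, p, hpi⟩
    by_cases hp : p < n
    · rw [partialConsensusMatrix_mulVec_of_lt _ hle x i p hp,
        G.lapMatrix_mulVec_eq_zero_iff_forall_reachable.2 fun j k _ => h j k p hp]
      rfl
    · exact partialConsensusMatrix_mulVec_of_le _ x _ (not_lt.1 hp)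
end

section
/- If L is a real symmetric positive semidefinite N×N matrix, then the partial-consensus matrix K_n is symmetric positive semidefinite. -/
/-- The partial-consensus matrix is the sum, over the shared coordinates `p < n`, of the
compressions of the lifted matrix `L` to the `p`-th coordinate of every block. -/
theorem partialConsensusMatrix_eq_sum (N : ℕ) (nn : Fin N → ℕ) (n : ℕ)
    (L : Matrix (Fin N) (Fin N) ℝ) :
    partialConsensusMatrix N nn n L =
      ∑ p ∈ Finset.range n,
        (Matrix.diagonal fun a : (i : Fin N) × Fin (nn i) =>
            if (a.2 : ℕ) = p then (1 : ℝ) else 0).conjTranspose *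
          L.submatrix Sigma.fst Sigma.fst *
          Matrix.diagonal fun a : (i : Fin N) × Fin (nn i) =>
            if (a.2 : ℕ) = p then (1 : ℝ) else 0 := by
  ext a b
  simp only [Matrix.sum_apply, Matrix.diagonal_conjTranspose, Matrix.mul_diagonal,
    Matrix.diagonal_mul, Matrix.submatrix_apply, star_trivial, ite_mul, one_mul,
    zero_mul, Finset.sum_ite_eq, mul_ite, mul_one, mul_zero, Finset.mem_range,
    partialConsensusMatrix]
  grind

/-- If `L` is real symmetric positive semidefinite, then so is the
partial-consensus matrix `K_n`. -/
theorem stmt2 (N : ℕ) (hN : 1 ≤ N) (nn : Fin N → ℕ) (hnn : ∀ i, 1 ≤ nn i)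
    (n : ℕ) (hn : 1 ≤ n) (hle : ∀ i, n ≤ nn i)
    (L : Matrix (Fin N) (Fin N) ℝ) (hL : L.PosSemidef) :
    (partialConsensusMatrix N nn n L).PosSemidef := by
  rw [partialConsensusMatrix_eq_sum]
  exact Matrix.posSemidef_sum _ fun p _ =>
    (hL.submatrix Sigma.fst).conjTranspose_mul_mul_same _
end

section
/- The characteristic polynomial of the partial-consensus matrix K_n equals X^{N̄ − nN} times the characteristic polynomial of the Kronecker product L ⊗ I_n. Consequently the multiset of eigenvalues of K_n is that of L ⊗ I_n together with N̄ − nN extra zeros. -/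
open scoped Kronecker

/-- If the columns of `M` outside the range of an injective `f` vanish, then `M` has the same
characteristic polynomial as its principal submatrix along `f`, up to a power of `X`. -/
theorem Matrix.charpoly_eq_X_pow_mul_charpoly_submatrix {R m k : Type*} [CommRing R]
    [Fintype m] [DecidableEq m] [Fintype k] [DecidableEq k] (M : Matrix m m R) {f : k → m}
    (hf : Function.Injective f) (hM : ∀ a, ∀ b ∉ Set.range f, M a b = 0) :
    M.charpoly =
      Polynomial.X ^ (Fintype.card m - Fintype.card k) * (M.submatrix f f).charpoly := by
  have hfactor : M.submatrix id f * (1 : Matrix m m R).submatrix f id = M := by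
    ext a b
    simp only [Matrix.mul_apply, Matrix.submatrix_apply, id_eq, Matrix.one_apply, mul_ite, mul_one,
      mul_zero]
    by_cases hb : b ∈ Set.range f
    · obtain ⟨c, rfl⟩ := hb
      simp [hf.eq_iff]
    · rw [hM a b hb]
      exact Finset.sum_eq_zero fun c _ => if_neg fun h => hb ⟨c, h⟩
  have hswap : (1 : Matrix m m R).submatrix f id * M.submatrix id f = M.submatrix f f := by
    rw [← Matrix.submatrix_mul _ _ f id f Function.bijective_id, one_mul]
  conv_lhs => rw [← hfactor]
  rw [Matrix.charpoly_mul_comm_of_le _ _ (Fintype.card_le_of_injective f hf), hswap]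

/-- The characteristic polynomial of `K_n` is `X^(N̄ - n·N)` times the
characteristic polynomial of `L ⊗ I_n`; consequently the eigenvalues (with multiplicity)
of `K_n` are those of `L ⊗ I_n` together with `N̄ - n·N` extra zeros. -/
theorem stmt3 (N : ℕ) (hN : 1 ≤ N) (nn : Fin N → ℕ) (hnn : ∀ i, 1 ≤ nn i)
    (n : ℕ) (hn : 1 ≤ n) (hle : ∀ i, n ≤ nn i)
    (L : Matrix (Fin N) (Fin N) ℝ) :
    (partialConsensusMatrix N nn n L).charpoly =
        Polynomial.X ^ ((∑ i, nn i) - n * N) *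
          (L ⊗ₖ (1 : Matrix (Fin n) (Fin n) ℝ)).charpoly ∧
      (partialConsensusMatrix N nn n L).charpoly.roots =
        (L ⊗ₖ (1 : Matrix (Fin n) (Fin n) ℝ)).charpoly.roots +
          Multiset.replicate ((∑ i, nn i) - n * N) 0 := by
  have hf : Function.Injective
      (fun x : Fin N × Fin n => (⟨x.1, Fin.castLE (hle x.1) x.2⟩ : (i : Fin N) × Fin (nn i))) := by
    rintro ⟨i, p⟩ ⟨j, q⟩ h
    obtain ⟨rfl, h⟩ := Sigma.mk.inj_iff.mp h
    simpa using h
  have hcharpoly := Matrix.charpoly_eq_X_pow_mul_charpoly_submatrix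
    (partialConsensusMatrix N nn n L) hf (by
      rintro a ⟨j, q⟩ hb
      exact if_neg fun (h : (a.2 : ℕ) = q ∧ (a.2 : ℕ) < n) => hb ⟨(j, ⟨q, h.1 ▸ h.2⟩), rfl⟩)
  have hsub : (partialConsensusMatrix N nn n L).submatrix
      (fun x : Fin N × Fin n => (⟨x.1, Fin.castLE (hle x.1) x.2⟩ : (i : Fin N) × Fin (nn i)))
      (fun x : Fin N × Fin n => (⟨x.1, Fin.castLE (hle x.1) x.2⟩ : (i : Fin N) × Fin (nn i))) =
      L ⊗ₖ (1 : Matrix (Fin n) (Fin n) ℝ) := by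
    ext ⟨i, p⟩ ⟨j, q⟩
    simp [partialConsensusMatrix, Matrix.one_apply, Fin.ext_iff]
  rw [hsub] at hcharpoly
  simp only [Fintype.card_sigma, Fintype.card_prod, Fintype.card_fin, mul_comm N n] at hcharpoly
  refine ⟨hcharpoly, ?_⟩
  rw [hcharpoly, Polynomial.roots_mul
    (mul_ne_zero (pow_ne_zero _ Polynomial.X_ne_zero) (Matrix.charpoly_monic _).ne_zero),
    Polynomial.roots_X_pow, Multiset.nsmul_singleton, add_comm]
end

section
/- (Equilibrium points of the RNN algorithm solve the optimization problem.) Let x̂ ∈ ℝ^{N̄} with x̂_i ∈ Ω_i for all i, let λ̂ ∈ ℝ^{N̄}, and let μ̂_i ∈ ℝ^{m_i}. Suppose there exist subgradients ξ_i of f_i at x̂_i and subgradients η_{ij} of g_{ij} at x̂_i such that, writing p̂_i ∈ ℝ^{m_i} for the componentwise positive part of μ̂_i + g_i(x̂_i), the following hold: (i) p̂_i = μ̂_i for all i (equilibrium of the μ-dynamics); (ii) K_n x̂ = 0 (equilibrium of the λ-dynamics); (iii) x̂ is a projection onto Ω = Ω_1 × ⋯ × Ω_N of the point z ∈ ℝ^{N̄}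 whose i-th block is x̂_i − ξ_i − Σ_{j=1}^{m_i} p̂_{ij} η_{ij} − w_i, where w_i is the i-th block of K_n λ̂ + K_n x̂; concretely, ⟨x̂ − z, y − x̂⟩ ≥ 0 for all y ∈ Ω. Then x̂ is a global minimizer of F(x) = Σ_{i=1}^N f_i(x_i) over the feasible set {x : x_i ∈ Ω_i, K_n x = 0, g_{ij}(x_i) ≤ 0 for all i, j}. -/
open Matrix

theorem partialConsensusMatrix_isSymm (N : ℕ) (nn : Fin N → ℕ) (n : ℕ)
    {L : Matrix (Fin N) (Fin N) ℝ} (hL : L.IsSymm) :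
    (partialConsensusMatrix N nn n L).IsSymm := by
  ext a b
  have hab : L b.1 a.1 = L a.1 b.1 := hL.apply a.1 b.1
  simp only [transpose_apply, partialConsensusMatrix, hab]
  congr 1
  grind

/-- The image of a symmetric matrix is orthogonal to its kernel. -/
theorem mulVec_dotProduct_eq_zero_of_isSymm {ι : Type*} [Fintype ι] {K : Matrix ι ι ℝ}
    (hK : K.IsSymm) (u : ι → ℝ) {v : ι → ℝ} (hv : K *ᵥ v = 0) : (K *ᵥ u) ⬝ᵥ v = 0 := by
  rw [dotProduct_comm, dotProduct_mulVec, ← mulVec_transpose, hK.eq, hv, zero_dotProduct]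

/-- Subgradients of constraint functions at `x`, weighted by nonnegative multipliers that satisfy
complementary slackness at `x`, pair nonpositively with directions towards feasible points. -/
theorem sum_smul_subgradient_dotProduct_nonpos {ι κ : Type*} [Fintype ι] [Fintype κ]
    {g : κ → (ι → ℝ) → ℝ} {x y : ι → ℝ} {p : κ → ℝ} {η : κ → ι → ℝ}
    (hη : ∀ j, η j ⬝ᵥ (y - x) ≤ g j y - g j x) (hp : ∀ j, 0 ≤ p j)
    (hslack : ∀ j, p j * g j x = 0) (hy : ∀ j, g j y ≤ 0) :
    (∑ j, p j • η j) ⬝ᵥ (y - x) ≤ 0 := by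
  rw [sum_dotProduct]
  refine Finset.sum_nonpos fun j _ => ?_
  rw [smul_dotProduct, smul_eq_mul]
  nlinarith [mul_le_mul_of_nonneg_left (hη j) (hp j),
    mul_nonpos_of_nonneg_of_nonpos (hp j) (hy j), hslack j]

/-- **equilibrium points of the RNN algorithm solve the problem.**
Let `xhat` (with `xhat i ∈ Ω i`), `lam` and `mu` be given, with subgradients `ξ i` of
`f i` and `η i j` of `g i · j` at `xhat i`.  Let `phat i` be the componentwise positive
part of `mu i + g i (xhat i)`.  If (i) `phat i = mu i`, (ii) `K_n xhat = 0`, and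
(iii) `xhat` is the projection onto `Ω = ∏ i, Ω i` of the point `z` whose `i`-th block
is `xhat i - ξ i - ∑ j phat i j • η i j - w i` (with `w i` the `i`-th block of
`K_n lam + K_n xhat`), concretely `⟨xhat - z, y - xhat⟩ ≥ 0` for all `y ∈ Ω`, then
`xhat` is a global minimizer of `∑ i, f i (x i)` over the feasible set. -/
theorem stmt10
    (N : ℕ) (hN : 1 ≤ N) (nn : Fin N → ℕ) (hnn : ∀ i, 1 ≤ nn i)
    (n : ℕ) (hn : 1 ≤ n) (hle : ∀ i, n ≤ nn i)
    (G : SimpleGraph (Fin N)) [DecidableRel G.Adj] (hG : G.Connected)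
    (m : Fin N → ℕ)
    (Ω : (i : Fin N) → Set (Fin (nn i) → ℝ))
    (hΩne : ∀ i, (Ω i).Nonempty) (hΩc : ∀ i, IsClosed (Ω i))
    (hΩconv : ∀ i, Convex ℝ (Ω i))
    (f : (i : Fin N) → (Fin (nn i) → ℝ) → ℝ)
    (hf : ∀ i, ConvexOn ℝ Set.univ (f i)) (hfc : ∀ i, Continuous (f i))
    (g : (i : Fin N) → (Fin (nn i) → ℝ) → (Fin (m i) → ℝ))
    (hg : ∀ i j, ConvexOn ℝ Set.univ (fun y => g i y j))
    (hgc : ∀ i j, Continuous (fun y => g i y j))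
    -- the candidate equilibrium point
    (xhat : (i : Fin N) → (Fin (nn i) → ℝ)) (hxhat : ∀ i, xhat i ∈ Ω i)
    (lam : ((i : Fin N) × Fin (nn i)) → ℝ)
    (mu : (i : Fin N) → Fin (m i) → ℝ)
    -- subgradients at xhat
    (ξ : (i : Fin N) → Fin (nn i) → ℝ)
    (hξ : ∀ i y, f i y - f i (xhat i) ≥ ξ i ⬝ᵥ (y - xhat i))
    (η : (i : Fin N) → Fin (m i) → Fin (nn i) → ℝ)
    (hη : ∀ i j y, g i y j - g i (xhat i) j ≥ η i j ⬝ᵥ (y - xhat i))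
    -- phat i = componentwise positive part of mu i + g i (xhat i)
    (phat : (i : Fin N) → Fin (m i) → ℝ)
    (hphat : ∀ i j, phat i j = max (mu i j + g i (xhat i) j) 0)
    -- (i) equilibrium of the μ-dynamics
    (heq1 : ∀ i, phat i = mu i)
    -- (ii) equilibrium of the λ-dynamics
    (heq2 : (partialConsensusMatrix N nn n (G.lapMatrix ℝ)).mulVec
      (fun a => xhat a.1 a.2) = 0)
    -- (iii) xhat is a projection onto Ω of z:  ⟨xhat - z, y - xhat⟩ ≥ 0 for y ∈ Ω
    (z : (i : Fin N) → (Fin (nn i) → ℝ))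
    (hz : ∀ i, z i = xhat i - ξ i - (∑ j, phat i j • η i j) -
      (fun p => ((partialConsensusMatrix N nn n (G.lapMatrix ℝ)).mulVec lam +
        (partialConsensusMatrix N nn n (G.lapMatrix ℝ)).mulVec
          (fun a => xhat a.1 a.2)) ⟨i, p⟩))
    (heq3 : ∀ y : (i : Fin N) → (Fin (nn i) → ℝ), (∀ i, y i ∈ Ω i) →
      0 ≤ ∑ i, (xhat i - z i) ⬝ᵥ (y i - xhat i)) :
    -- conclusion: xhat is a global minimizer over the feasible set
    ∀ x : (i : Fin N) → (Fin (nn i) → ℝ),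
      (∀ i, x i ∈ Ω i) →
      (partialConsensusMatrix N nn n (G.lapMatrix ℝ)).mulVec (fun a => x a.1 a.2) = 0 →
      (∀ i j, g i (x i) j ≤ 0) →
      ∑ i, f i (xhat i) ≤ ∑ i, f i (x i) := by
  intro x hxΩ hxK hxg
  set K := partialConsensusMatrix N nn n (G.lapMatrix ℝ)
  have hKsymm : K.IsSymm := partialConsensusMatrix_isSymm N nn n (G.isSymm_lapMatrix (R := ℝ))
  have hker : K *ᵥ (fun a => x a.1 a.2 - xhat a.1 a.2) = 0 := by
    have h := mulVec_sub K (fun a => x a.1 a.2) (fun a => xhat a.1 a.2)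
    rw [hxK, heq2, sub_zero] at h
    exact h
  have hconsensus : ∑ i, (fun p => (K *ᵥ lam) ⟨i, p⟩) ⬝ᵥ (x i - xhat i) = 0 := by
    rw [← mulVec_dotProduct_eq_zero_of_isSymm hKsymm lam hker]
    simp only [dotProduct, Fintype.sum_sigma, Pi.sub_apply]
  have hconstraint (i : Fin N) : (∑ j, phat i j • η i j) ⬝ᵥ (x i - xhat i) ≤ 0 := by
    refine sum_smul_subgradient_dotProduct_nonpos (g := fun j y => g i y j)
      (fun j => hη i j (x i)) (fun j => ?_) (fun j => ?_) (hxg i)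
    · rw [hphat]
      exact le_max_right _ _
    · have h := hphat i j
      rw [← heq1 i] at h
      rcases max_choice (phat i j + g i (xhat i) j) 0 with h' | h' <;> rw [h'] at h
      · have hg0 : g i (xhat i) j = 0 := by linarith
        simp [hg0]
      · simp [h]
  have hblock (i : Fin N) : (xhat i - z i) ⬝ᵥ (x i - xhat i) ≤
      f i (x i) - f i (xhat i) + (fun p => (K *ᵥ lam) ⟨i, p⟩) ⬝ᵥ (x i - xhat i) := by
    have hsplit : xhat i - z i =
        ξ i + (∑ j, phat i j • η i j) + (fun p => (K *ᵥ lam) ⟨i, p⟩) := by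
      rw [hz i, heq2, add_zero]
      abel
    rw [hsplit, add_dotProduct, add_dotProduct]
    linarith [hξ i (x i), hconstraint i]
  have hsum := (heq3 x hxΩ).trans (Finset.sum_le_sum fun i _ => hblock i)
  rw [Finset.sum_add_distrib, hconsensus, Finset.sum_sub_distrib] at hsum
  linarith
end
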